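/- arXiv:2001.06788 — 2 statements merged into one kernel-verified Lean document; each statement's English description precedes it below -/
import Mathlib

section
/- For every integer n ≥ 1, the minimal polynomial of the complex matrix A_n is X^{2n+3} − 4X^{2n+2} + 4X^{2n+1} − 4X (which factors as X·(X^{n+1} − 2X^n − 2)·(X^{n+1} − 2X^n + 2)), and the characteristic polynomial of A_n is X^{2n+4} − 4X^{2n+3} + 4X^{2n+2} − 4X², i.e., X times the minimal polynomial. -/
open Matrix

/-- The paired tent map `T_κ : [-1,1] → [-1,1]`. -/
noncomputable def pairedTent (κ : ℝ) (x : ℝ) : ℝ :=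
  if x ≤ -(1/2) then 2*(1+κ)*(x+1) - 1
  else if x < 0 then -(2*(1+κ))*x - 1
  else if x = 0 then 0
  else if x ≤ 1/2 then -(2*(1+κ))*x + 1
  else 2*(1+κ)*(x-1) + 1

/-- The partition points `p_0 < ⋯ < p_{2n+4}` of the Markov partition for `T_{κ_n}`. -/
noncomputable def markovPoint (n : ℕ) (κ : ℝ) (i : ℕ) : ℝ :=
  if i = 0 then -1
  else if i < n then (2 + 2*κ)^i * κ - 1
  else if i = n then -(1/2)
  else if i = n + 1 then -κ
  else if i = n + 2 then 0
  else if i = n + 3 then κ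
  else if i = n + 4 then 1/2
  else if i < 2*n + 4 then 1 - (2 + 2*κ)^(2*n + 4 - i) * κ
  else 1

/-- The interval `R_i = (p_{i-1}, p_i)`, for `1 ≤ i ≤ 2n+4`. -/
noncomputable def markovInterval (n : ℕ) (κ : ℝ) (i : ℕ) : Set ℝ :=
  Set.Ioo (markovPoint n κ (i - 1)) (markovPoint n κ i)

open scoped Classical in
/-- The `(2n+4) × (2n+4)` adjacency matrix `A_n`: the `(i,j)` entry (1-based) is `1`
if `R_i ⊆ T_n(R_j)` and `0` otherwise. -/
noncomputable def Amat (n : ℕ) (κ : ℝ) : Matrix (Fin (2*n + 4)) (Fin (2*n + 4)) ℂ :=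
  Matrix.of fun i j =>
    if markovInterval n κ ((i : ℕ) + 1) ⊆ pairedTent κ '' markovInterval n κ ((j : ℕ) + 1)
    then 1 else 0

/-- The `(2n+4) × (2n+4)` exchange matrix `J_n`: entry `(i,j)` (1-based) is `1` iff
`i + j = 2n+5`. -/
def Jmat (n : ℕ) : Matrix (Fin (2*n + 4)) (Fin (2*n + 4)) ℂ :=
  Matrix.of fun i j => if (i : ℕ) + 1 + ((j : ℕ) + 1) = 2*n + 5 then 1 else 0


/-! ### The partition points -/

theorem pt_zero (n : ℕ) (κ : ℝ) : markovPoint n κ 0 = -1 := by simp [markovPoint]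

theorem pt_mid (n : ℕ) (κ : ℝ) (k : ℕ) (h1 : 1 ≤ k) (h2 : k < n) :
    markovPoint n κ k = (2 + 2*κ)^k * κ - 1 := by
  unfold markovPoint
  rw [if_neg (by omega), if_pos h2]

theorem pt_n (n : ℕ) (κ : ℝ) (hn : 1 ≤ n) : markovPoint n κ n = -(1/2) := by
  unfold markovPoint
  rw [if_neg (by omega), if_neg (by omega), if_pos rfl]

theorem pt_n1 (n : ℕ) (κ : ℝ) : markovPoint n κ (n+1) = -κ := by
  unfold markovPoint
  rw [if_neg (by omega), if_neg (by omega), if_neg (by omega), if_pos rfl]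

theorem pt_n2 (n : ℕ) (κ : ℝ) : markovPoint n κ (n+2) = 0 := by
  unfold markovPoint
  rw [if_neg (by omega), if_neg (by omega), if_neg (by omega), if_neg (by omega), if_pos rfl]

theorem pt_n3 (n : ℕ) (κ : ℝ) : markovPoint n κ (n+3) = κ := by
  unfold markovPoint
  rw [if_neg (by omega), if_neg (by omega), if_neg (by omega), if_neg (by omega),
    if_neg (by omega), if_pos rfl]

theorem pt_n4 (n : ℕ) (κ : ℝ) : markovPoint n κ (n+4) = 1/2 := by
  unfold markovPoint
  rw [if_neg (by omega), if_neg (by omega), if_neg (by omega), if_neg (by omega),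
    if_neg (by omega), if_neg (by omega), if_pos rfl]

theorem pt_right (n : ℕ) (κ : ℝ) (k : ℕ) (h1 : 1 ≤ k) (h2 : k < n) :
    markovPoint n κ (2*n+4-k) = 1 - (2 + 2*κ)^k * κ := by
  unfold markovPoint
  rw [if_neg (by omega), if_neg (by omega), if_neg (by omega), if_neg (by omega),
    if_neg (by omega), if_neg (by omega), if_neg (by omega), if_pos (by omega),
    show 2*n+4-(2*n+4-k) = k by omega]

theorem pt_last (n : ℕ) (κ : ℝ) (hn : 1 ≤ n) : markovPoint n κ (2*n+4) = 1 := by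
  unfold markovPoint
  rw [if_neg (by omega), if_neg (by omega), if_neg (by omega), if_neg (by omega),
    if_neg (by omega), if_neg (by omega), if_neg (by omega), if_neg (by omega)]

theorem pt_symm_left (n : ℕ) (κ : ℝ) (hn : 1 ≤ n) (k : ℕ) (hk : k ≤ n+2) :
    markovPoint n κ (2*n+4-k) = - markovPoint n κ k := by
  have : k = 0 ∨ (1 ≤ k ∧ k < n) ∨ k = n ∨ k = n+1 ∨ k = n+2 := by omega
  rcases this with rfl | ⟨h1, h2⟩ | rfl | rfl | rfl
  · rw [pt_zero, Nat.sub_zero, pt_last n κ hn]; norm_num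
  · rw [pt_right n κ k h1 h2, pt_mid n κ k h1 h2]; ring
  · rw [show 2*k+4-k = k+4 by omega, pt_n4, pt_n k κ hn]; norm_num
  · rw [show 2*n+4-(n+1) = n+3 by omega, pt_n3, pt_n1]; norm_num
  · rw [show 2*n+4-(n+2) = n+2 by omega, pt_n2]; norm_num

theorem pt_symm (n : ℕ) (κ : ℝ) (hn : 1 ≤ n) (k : ℕ) (hk : k ≤ 2*n+4) :
    markovPoint n κ (2*n+4-k) = - markovPoint n κ k := by
  rcases Nat.lt_or_ge (n+2) k with h | h
  · have := pt_symm_left n κ hn (2*n+4-k) (by omega)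
    rw [show 2*n+4-(2*n+4-k) = k by omega] at this
    rw [this, neg_neg]
  · exact pt_symm_left n κ hn k h

theorem pt_lt_left (n : ℕ) (hn : 1 ≤ n) (κ : ℝ) (hκ : κ ∈ Set.Ioo (0 : ℝ) (1/2))
    (heq : (2 + 2*κ)^n * κ = 1) (k : ℕ) (hk : k ≤ n + 1) :
    markovPoint n κ k < markovPoint n κ (k+1) := by
  obtain ⟨h0, h1⟩ := hκ
  have hp : ∀ m, 0 < (2 + 2*κ)^m * κ := fun m => by positivity
  rcases Nat.lt_or_ge k n with h | h
  · rcases Nat.lt_or_ge (k+1) n with h' | h'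
    · rcases Nat.eq_zero_or_pos k with rfl | h''
      · rw [pt_zero, pt_mid n κ (0+1) (by omega) (by omega)]
        have := hp (0+1)
        linarith
      · rw [pt_mid n κ k h'' h, pt_mid n κ (k+1) (by omega) h', pow_succ]
        have := hp k
        nlinarith
    · have hh : n = k + 1 := by omega
      subst hh
      rw [pt_n _ _ hn]
      rcases Nat.eq_zero_or_pos k with rfl | h''
      · rw [pt_zero]; norm_num
      · rw [pt_mid _ κ k h'' h]
        rw [pow_succ] at heq
        have := hp k
        nlinarith
  · have : k = n ∨ k = n+1 := by omega
    rcases this with rfl | rfl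
    · rw [pt_n _ _ hn, pt_n1]; linarith
    · rw [pt_n1, pt_n2]; linarith

theorem pt_lt_succ (n : ℕ) (hn : 1 ≤ n) (κ : ℝ) (hκ : κ ∈ Set.Ioo (0 : ℝ) (1/2))
    (heq : (2 + 2*κ)^n * κ = 1) (k : ℕ) (hk : k < 2*n+4) :
    markovPoint n κ k < markovPoint n κ (k+1) := by
  rcases Nat.lt_or_ge k (n+2) with h | h
  · exact pt_lt_left n hn κ hκ heq k (by omega)
  · have h1 := pt_lt_left n hn κ hκ heq (2*n+4-(k+1)) (by omega)
    rw [show 2*n+4-(k+1)+1 = 2*n+4-k by omega, pt_symm n κ hn (k+1) (by omega),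
      pt_symm n κ hn k (by omega)] at h1
    linarith

theorem pt_lt (n : ℕ) (hn : 1 ≤ n) (κ : ℝ) (hκ : κ ∈ Set.Ioo (0 : ℝ) (1/2))
    (heq : (2 + 2*κ)^n * κ = 1) (k l : ℕ) (hkl : k < l) (hl : l ≤ 2*n+4) :
    markovPoint n κ k < markovPoint n κ l := by
  induction l, hkl using Nat.le_induction with
  | base => exact pt_lt_succ n hn κ hκ heq k (by omega)
  | succ m hm ih => exact (ih (by omega)).trans (pt_lt_succ n hn κ hκ heq m (by omega))

theorem pt_le_iff (n : ℕ) (hn : 1 ≤ n) (κ : ℝ) (hκ : κ ∈ Set.Ioo (0 : ℝ) (1/2))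
    (heq : (2 + 2*κ)^n * κ = 1) (k l : ℕ) (hk : k ≤ 2*n+4) (hl : l ≤ 2*n+4) :
    markovPoint n κ k ≤ markovPoint n κ l ↔ k ≤ l := by
  constructor
  · intro h
    by_contra hh
    exact absurd (pt_lt n hn κ hκ heq l k (by omega) hk) (not_lt.mpr h)
  · intro h
    rcases h.eq_or_lt with rfl | h
    · exact le_rfl
    · exact (pt_lt n hn κ hκ heq k l h hl).le

/-! ### Images of the intervals -/

theorem image_inc (f : ℝ → ℝ) (m c u v : ℝ) (hm : 0 < m)
    (hf : ∀ x ∈ Set.Ioo u v, f x = m * x + c) :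
    f '' Set.Ioo u v = Set.Ioo (m*u+c) (m*v+c) := by
  ext y
  constructor
  · rintro ⟨x, hx, rfl⟩
    rw [hf x hx]
    exact ⟨by nlinarith [hx.1], by nlinarith [hx.2]⟩
  · rintro ⟨h1, h2⟩
    have hx : (y - c)/m ∈ Set.Ioo u v :=
      ⟨by rw [lt_div_iff₀ hm]; linarith, by rw [div_lt_iff₀ hm]; linarith⟩
    refine ⟨(y-c)/m, hx, ?_⟩
    rw [hf _ hx]
    field_simp
    ring

theorem image_dec (f : ℝ → ℝ) (m c u v : ℝ) (hm : 0 < m)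
    (hf : ∀ x ∈ Set.Ioo u v, f x = -m * x + c) :
    f '' Set.Ioo u v = Set.Ioo (-m*v+c) (-m*u+c) := by
  ext y
  constructor
  · rintro ⟨x, hx, rfl⟩
    rw [hf x hx]
    exact ⟨by nlinarith [hx.2], by nlinarith [hx.1]⟩
  · rintro ⟨h1, h2⟩
    have hx : (c - y)/m ∈ Set.Ioo u v :=
      ⟨by rw [lt_div_iff₀ hm]; linarith, by rw [div_lt_iff₀ hm]; linarith⟩
    refine ⟨(c-y)/m, hx, ?_⟩
    rw [hf _ hx]
    field_simp
    ring

/-- Index of the image of the `k`-th partition point (left half, left limit at `0`). -/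
def tauIdx (n k : ℕ) : ℕ :=
  if k = 0 then 0
  else if k + 1 < n then k + 1
  else if k + 1 = n then n + 2
  else if k = n then n + 3
  else if k = n + 1 then (if n = 1 then 3 else 1)
  else 0

theorem tau_inc (n : ℕ) (hn : 1 ≤ n) (κ : ℝ)
    (heq : (2 + 2*κ)^n * κ = 1) (k : ℕ) (hk : k ≤ n) :
    2*(1+κ)*markovPoint n κ k + (2*(1+κ) - 1) = markovPoint n κ (tauIdx n k) := by
  unfold tauIdx
  split_ifs with h1 h2 h3 h4 h5 h6
  · subst h1; rw [pt_zero]; ring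
  · rw [pt_mid n κ k (by omega) (by omega), pt_mid n κ (k+1) (by omega) (by omega)]; ring
  · rw [pt_mid n κ k (by omega) (by omega), pt_n2]
    rw [← h3] at heq
    linear_combination heq
  · rw [h4, pt_n n κ hn, pt_n3]; ring
  all_goals omega

theorem tau_dec (n : ℕ) (hn : 1 ≤ n) (κ : ℝ)
    (heq : (2 + 2*κ)^n * κ = 1) (k : ℕ) (hk : n ≤ k) (hk2 : k ≤ n + 2) :
    -(2*(1+κ))*markovPoint n κ k + (-1) = markovPoint n κ (tauIdx n k) := by
  unfold tauIdx
  split_ifs with h1 h2 h3 h4 h5 h6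
  · omega
  · omega
  · omega
  · rw [h4, pt_n n κ hn, pt_n3]; ring
  · subst h6
    rw [h5, pt_n1, show 3 = 1 + 2 from rfl, pt_n2]
    linear_combination heq
  · rw [h5, pt_n1, pt_mid n κ 1 le_rfl (by omega)]; ring
  · rw [show k = n + 2 by omega, pt_n2, pt_zero]; ring

theorem image_left (n : ℕ) (hn : 1 ≤ n) (κ : ℝ) (hκ : κ ∈ Set.Ioo (0 : ℝ) (1/2))
    (heq : (2 + 2*κ)^n * κ = 1) (j : ℕ) (hj : j < n) :
    pairedTent κ '' markovInterval n κ (j+1) =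
      Set.Ioo (markovPoint n κ (tauIdx n j)) (markovPoint n κ (tauIdx n (j+1))) := by
  rw [← tau_inc n hn κ heq j (by omega), ← tau_inc n hn κ heq (j+1) (by omega)]
  unfold markovInterval
  rw [Nat.add_sub_cancel]
  apply image_inc
  · have := hκ.1; linarith
  · intro x hx
    have h1 : x < -(1/2) := by
      rw [← pt_n n κ hn]
      exact hx.2.trans_le ((pt_le_iff n hn κ hκ heq _ _ (by omega) (by omega)).2 (by omega))
    unfold pairedTent
    rw [if_pos h1.le]; ring

theorem image_right (n : ℕ) (hn : 1 ≤ n) (κ : ℝ) (hκ : κ ∈ Set.Ioo (0 : ℝ) (1/2))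
    (heq : (2 + 2*κ)^n * κ = 1) (j : ℕ) (hj : n ≤ j) (hj2 : j ≤ n + 1) :
    pairedTent κ '' markovInterval n κ (j+1) =
      Set.Ioo (markovPoint n κ (tauIdx n (j+1))) (markovPoint n κ (tauIdx n j)) := by
  rw [← tau_dec n hn κ heq j (by omega) (by omega),
    ← tau_dec n hn κ heq (j+1) (by omega) (by omega)]
  unfold markovInterval
  rw [Nat.add_sub_cancel]
  apply image_dec
  · have := hκ.1; linarith
  · intro x hx
    have h1 : -(1/2) < x := by
      rw [← pt_n n κ hn]
      exact ((pt_le_iff n hn κ hκ heq _ _ (by omega) (by omega)).2 (by omega)).trans_lt hx.1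
    have h2 : x < 0 := by
      rw [← pt_n2 n κ]
      exact hx.2.trans_le ((pt_le_iff n hn κ hκ heq _ _ (by omega) (by omega)).2 (by omega))
    unfold pairedTent
    rw [if_neg (not_le.mpr h1), if_pos h2]; ring

theorem tent_neg (κ x : ℝ) : pairedTent κ (-x) = - pairedTent κ x := by
  unfold pairedTent
  rcases lt_trichotomy x 0 with h | rfl | h
  · rw [if_neg (show ¬ -x ≤ -(1/2) by linarith), if_neg (show ¬ -x < 0 by linarith),
      if_neg (show ¬ -x = 0 by linarith)]
    rcases lt_trichotomy x (-(1/2)) with h' | rfl | h'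
    · rw [if_neg (by linarith), if_pos (by linarith)]; ring
    · norm_num; ring
    · rw [if_pos (by linarith), if_neg (by linarith), if_pos (by linarith)]; ring
  · norm_num
  · rw [if_neg (show ¬ x ≤ -(1/2) by linarith), if_neg (show ¬ x < 0 by linarith),
      if_neg (show ¬ x = 0 by linarith)]
    rcases lt_trichotomy x (1/2) with h' | rfl | h'
    · rw [if_neg (by linarith), if_pos (by linarith), if_pos (by linarith)]; ring
    · norm_num; ring
    · rw [if_pos (by linarith), if_neg (by linarith)]; ring

theorem interval_neg (n : ℕ) (κ : ℝ) (hn : 1 ≤ n) (k : ℕ) (hk : k < 2*n+4) :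
    markovInterval n κ (2*n+3-k+1) = (fun x => -x) '' markovInterval n κ (k+1) := by
  unfold markovInterval
  rw [Nat.add_sub_cancel, Nat.add_sub_cancel]
  rw [show 2*n+3-k = 2*n+4-(k+1) by omega, pt_symm n κ hn (k+1) (by omega),
    show 2*n+4-(k+1)+1 = 2*n+4-k by omega, pt_symm n κ hn k (by omega)]
  simp

theorem subset_symm (n : ℕ) (κ : ℝ) (hn : 1 ≤ n) (i j : ℕ) (hi : i < 2*n+4) (hj : j < 2*n+4) :
    markovInterval n κ (2*n+3-i+1) ⊆ pairedTent κ '' markovInterval n κ (2*n+3-j+1) ↔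
    markovInterval n κ (i+1) ⊆ pairedTent κ '' markovInterval n κ (j+1) := by
  rw [interval_neg n κ hn i hi, interval_neg n κ hn j hj, Set.image_image]
  simp_rw [tent_neg]
  rw [← Set.image_image (fun x => -x) (pairedTent κ)]
  exact Set.image_subset_image_iff neg_injective

/-- Row pattern of the top `n` rows (0-based). -/
def topRow (n i j : ℕ) : Prop :=
  (i = 0 ∧ (j = 0 ∨ j = n + 1)) ∨ (0 < i ∧ (j + 1 = i ∨ j = n))

/-- Row pattern of the top half. -/
def halfRow (n i j : ℕ) : Prop :=
  (i < n ∧ topRow n i j) ∨ (i = n ∧ topRow n (n-1) j) ∨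
  (i = n + 1 ∧ (topRow n (n-1) j ∨ j = n + 3 ∨ j = n + 4))

def fullRow (n i j : ℕ) : Prop :=
  if i < n + 2 then halfRow n i j else halfRow n (2*n+3-i) (2*n+3-j)

theorem fullRow_symm (n i j : ℕ) (hi : i < 2*n+4) (hj : j < 2*n+4) :
    fullRow n (2*n+3-i) (2*n+3-j) ↔ fullRow n i j := by
  unfold fullRow
  have h1 : 2*n+3-(2*n+3-i) = i := by omega
  have h2 : 2*n+3-(2*n+3-j) = j := by omega
  rw [h1, h2]
  by_cases h : i < n + 2
  · rw [if_neg (by omega), if_pos h]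
  · rw [if_pos (by omega), if_neg h]

theorem comb_left (n i j : ℕ) (hn : 1 ≤ n) (hj : j < n) (hi : i < 2*n+4) :
    (tauIdx n j ≤ i ∧ i + 1 ≤ tauIdx n (j+1)) ↔ fullRow n i j := by
  unfold fullRow halfRow topRow
  have h1 : tauIdx n j = if j = 0 then 0 else if j + 1 < n then j + 1 else n + 2 := by
    unfold tauIdx; split_ifs <;> omega
  have h2 : tauIdx n (j+1) = if j + 2 < n then j + 2 else if j + 2 = n then n+2 else n+3 := by
    unfold tauIdx; split_ifs <;> omega
  rw [h1, h2]
  clear h1 h2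
  by_cases hi2 : i < n + 2
  · rw [if_pos hi2]; split_ifs <;> omega
  · rw [if_neg hi2]; split_ifs <;> omega

theorem comb_right (n i j : ℕ) (hn : 1 ≤ n) (hj : n ≤ j) (hj2 : j ≤ n+1) (hi : i < 2*n+4) :
    (tauIdx n (j+1) ≤ i ∧ i + 1 ≤ tauIdx n j) ↔ fullRow n i j := by
  unfold fullRow halfRow topRow
  have h1 : tauIdx n j = if j = n then n + 3 else if n = 1 then 3 else 1 := by
    unfold tauIdx; split_ifs <;> omega
  have h2 : tauIdx n (j+1) = if j = n then (if n = 1 then 3 else 1) else 0 := by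
    unfold tauIdx; split_ifs <;> omega
  rw [h1, h2]
  clear h1 h2
  by_cases hi2 : i < n + 2
  · rw [if_pos hi2]; split_ifs <;> omega
  · rw [if_neg hi2]; split_ifs <;> omega

theorem subset_iff_left (n : ℕ) (hn : 1 ≤ n) (κ : ℝ) (hκ : κ ∈ Set.Ioo (0 : ℝ) (1/2))
    (heq : (2 + 2*κ)^n * κ = 1) (i j : ℕ) (hi : i < 2*n+4) (hj : j < n + 2) :
    markovInterval n κ (i+1) ⊆ pairedTent κ '' markovInterval n κ (j+1) ↔ fullRow n i j := by
  have hτ : ∀ k, tauIdx n k ≤ 2*n+4 := by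
    intro k; unfold tauIdx; split_ifs <;> omega
  have hlt := pt_lt_succ n hn κ hκ heq i hi
  rcases Nat.lt_or_ge j n with h | h
  · rw [image_left n hn κ hκ heq j h]
    unfold markovInterval
    rw [Nat.add_sub_cancel, Set.Ioo_subset_Ioo_iff hlt,
      pt_le_iff n hn κ hκ heq _ _ (hτ _) (by omega), pt_le_iff n hn κ hκ heq _ _ (by omega) (hτ _)]
    exact comb_left n i j hn h hi
  · rw [image_right n hn κ hκ heq j h (by omega)]
    unfold markovInterval
    rw [Nat.add_sub_cancel, Set.Ioo_subset_Ioo_iff hlt,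
      pt_le_iff n hn κ hκ heq _ _ (hτ _) (by omega), pt_le_iff n hn κ hκ heq _ _ (by omega) (hτ _)]
    exact comb_right n i j hn h (by omega) hi

theorem subset_iff (n : ℕ) (hn : 1 ≤ n) (κ : ℝ) (hκ : κ ∈ Set.Ioo (0 : ℝ) (1/2))
    (heq : (2 + 2*κ)^n * κ = 1) (i j : ℕ) (hi : i < 2*n+4) (hj : j < 2*n+4) :
    markovInterval n κ (i+1) ⊆ pairedTent κ '' markovInterval n κ (j+1) ↔ fullRow n i j := by
  rcases Nat.lt_or_ge j (n+2) with h | h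
  · exact subset_iff_left n hn κ hκ heq i j hi h
  · rw [← subset_symm n κ hn i j hi hj, ← fullRow_symm n i j hi hj]
    exact subset_iff_left n hn κ hκ heq _ _ (by omega) (by omega)

/-! ### The rows of the matrix -/

open scoped Classical in
theorem Amat_apply (n : ℕ) (hn : 1 ≤ n) (κ : ℝ) (hκ : κ ∈ Set.Ioo (0 : ℝ) (1/2))
    (heq : (2 + 2*κ)^n * κ = 1) (i j : Fin (2*n+4)) :
    Amat n κ i j = if fullRow n i j then 1 else 0 := by
  unfold Amat
  rw [Matrix.of_apply]
  exact if_congr (subset_iff n hn κ hκ heq i j i.2 j.2) rfl rfl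

theorem Amat_rev (n : ℕ) (hn : 1 ≤ n) (κ : ℝ) (hκ : κ ∈ Set.Ioo (0 : ℝ) (1/2))
    (heq : (2 + 2*κ)^n * κ = 1) (i j : Fin (2*n+4)) :
    Amat n κ i.rev j.rev = Amat n κ i j := by
  rw [Amat_apply n hn κ hκ heq, Amat_apply n hn κ hκ heq]
  have := fullRow_symm n i j i.2 j.2
  rw [Fin.val_rev, Fin.val_rev, show 2*n+4-((i:ℕ)+1) = 2*n+3-i by omega,
    show 2*n+4-((j:ℕ)+1) = 2*n+3-j by omega]
  by_cases h : fullRow n i j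
  · rw [if_pos h, if_pos (this.2 h)]
  · rw [if_neg h, if_neg (fun h' => h (this.1 h'))]

theorem Amat_mulVec_rev (n : ℕ) (hn : 1 ≤ n) (κ : ℝ) (hκ : κ ∈ Set.Ioo (0 : ℝ) (1/2))
    (heq : (2 + 2*κ)^n * κ = 1) (w : Fin (2*n+4) → ℂ) (i : Fin (2*n+4)) :
    (Amat n κ *ᵥ w) i.rev = (Amat n κ *ᵥ (fun j => w j.rev)) i := by
  simp only [Matrix.mulVec, dotProduct]
  rw [← Equiv.sum_comp Fin.revPerm]
  apply Finset.sum_congr rfl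
  intro j _
  rw [Fin.revPerm_apply, Amat_rev n hn κ hκ heq]

open scoped Classical in
theorem sum_pair (N : ℕ) (a b : ℕ) (ha : a < N) (hb : b < N) (hab : a ≠ b) (p : ℕ → Prop)
    (hp : ∀ j, p j ↔ (j = a ∨ j = b)) (w : Fin N → ℂ) :
    ∑ j : Fin N, (if p j then (1:ℂ) else 0) * w j = w ⟨a, ha⟩ + w ⟨b, hb⟩ := by
  have : ∀ j : Fin N, (if p j then (1:ℂ) else 0) * w j =
      (if j = ⟨a, ha⟩ then w j else 0) + (if j = ⟨b, hb⟩ then w j else 0) := by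
    intro j
    simp only [hp, Fin.ext_iff]
    by_cases h1 : (j:ℕ) = a
    · have : (j:ℕ) ≠ b := by omega
      simp [h1, hab]
    · simp [h1]
  simp only [this, Finset.sum_add_distrib, Finset.sum_ite_eq', Finset.mem_univ, if_true]

theorem row_zero (n : ℕ) (hn : 1 ≤ n) (κ : ℝ) (hκ : κ ∈ Set.Ioo (0 : ℝ) (1/2))
    (heq : (2 + 2*κ)^n * κ = 1) (w : Fin (2*n+4) → ℂ) :
    (Amat n κ *ᵥ w) ⟨0, by omega⟩ = w ⟨0, by omega⟩ + w ⟨n+1, by omega⟩ := by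
  classical
  simp only [Matrix.mulVec, dotProduct, Amat_apply n hn κ hκ heq]
  refine sum_pair _ 0 (n+1) _ _ (by omega) (fun j => fullRow n 0 j) ?_ w
  intro j
  unfold fullRow halfRow topRow
  rw [if_pos (by omega)]
  omega

theorem row_mid (n : ℕ) (hn : 1 ≤ n) (κ : ℝ) (hκ : κ ∈ Set.Ioo (0 : ℝ) (1/2))
    (heq : (2 + 2*κ)^n * κ = 1) (w : Fin (2*n+4) → ℂ) (i : ℕ) (hi : i + 1 < n) :
    (Amat n κ *ᵥ w) ⟨i+1, by omega⟩ = w ⟨i, by omega⟩ + w ⟨n, by omega⟩ := by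
  classical
  simp only [Matrix.mulVec, dotProduct, Amat_apply n hn κ hκ heq]
  refine sum_pair _ i n _ _ (by omega) (fun j => fullRow n (i+1) j) ?_ w
  intro j
  unfold fullRow halfRow topRow
  rw [if_pos (by omega)]
  omega

theorem row_n (n : ℕ) (hn : 1 ≤ n) (κ : ℝ) (hκ : κ ∈ Set.Ioo (0 : ℝ) (1/2))
    (heq : (2 + 2*κ)^n * κ = 1) (w : Fin (2*n+4) → ℂ) :
    (Amat n κ *ᵥ w) ⟨n, by omega⟩ = (Amat n κ *ᵥ w) ⟨n-1, by omega⟩ := by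
  classical
  simp only [Matrix.mulVec, dotProduct, Amat_apply n hn κ hκ heq]
  apply Finset.sum_congr rfl
  intro j _
  have : fullRow n n j ↔ fullRow n (n-1) j := by
    unfold fullRow halfRow topRow
    rw [if_pos (by omega), if_pos (by omega)]
    omega
  simp only [this]

theorem row_n1 (n : ℕ) (hn : 1 ≤ n) (κ : ℝ) (hκ : κ ∈ Set.Ioo (0 : ℝ) (1/2))
    (heq : (2 + 2*κ)^n * κ = 1) (w : Fin (2*n+4) → ℂ) :
    (Amat n κ *ᵥ w) ⟨n+1, by omega⟩ = (Amat n κ *ᵥ w) ⟨n-1, by omega⟩ +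
      (w ⟨n+3, by omega⟩ + w ⟨n+4, by omega⟩) := by
  classical
  rw [← sum_pair (2*n+4) (n+3) (n+4) (by omega) (by omega) (by omega)
    (fun j => j = n+3 ∨ j = n+4) (fun j => Iff.rfl) w]
  simp only [Matrix.mulVec, dotProduct, Amat_apply n hn κ hκ heq]
  rw [← Finset.sum_add_distrib]
  apply Finset.sum_congr rfl
  intro j _
  have h1 : fullRow n (n+1) j ↔ (fullRow n (n-1) j ∨ ((j:ℕ) = n+3 ∨ (j:ℕ) = n+4)) := by
    unfold fullRow halfRow topRow
    rw [if_pos (by omega), if_pos (by omega)]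
    omega
  have h2 : ¬ (fullRow n (n-1) j ∧ ((j:ℕ) = n+3 ∨ (j:ℕ) = n+4)) := by
    unfold fullRow halfRow topRow
    rw [if_pos (by omega)]
    omega
  rw [← add_mul]
  congr 1
  simp only [h1]
  by_cases ha : fullRow n (n-1) j
  · have hb : ¬ ((j:ℕ) = n+3 ∨ (j:ℕ) = n+4) := fun hb => h2 ⟨ha, hb⟩
    rw [if_pos (Or.inl ha), if_pos ha, if_neg hb]; ring
  · by_cases hb : ((j:ℕ) = n+3 ∨ (j:ℕ) = n+4)
    · rw [if_pos (Or.inr hb), if_neg ha, if_pos hb]; ring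
    · rw [if_neg (by tauto), if_neg ha, if_neg hb]; ring

/-! ### Semisimplicity of the eigenvalue zero -/

theorem ker_half (n : ℕ) (hn : 1 ≤ n) (κ : ℝ) (hκ : κ ∈ Set.Ioo (0 : ℝ) (1/2))
    (heq : (2 + 2*κ)^n * κ = 1) (v : Fin (2*n+4) → ℂ)
    (h : Amat n κ *ᵥ (Amat n κ *ᵥ v) = 0) (i : ℕ) (hi : i < n + 2) :
    (Amat n κ *ᵥ v) ⟨i, by omega⟩ = 0 := by
  set u := Amat n κ *ᵥ v with hu
  have e1 : u ⟨n, by omega⟩ = u ⟨n-1, by omega⟩ := row_n n hn κ hκ heq v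
  -- the rows of the mirror image
  have hrev : Amat n κ *ᵥ (fun j => u j.rev) = 0 := by
    funext k
    rw [← Amat_mulVec_rev n hn κ hκ heq, h]; rfl
  have e2 := row_n1 n hn κ hκ heq (fun j => u j.rev)
  rw [hrev] at e2
  have r1 : (⟨n+3, by omega⟩ : Fin (2*n+4)).rev = ⟨n, by omega⟩ := by
    ext; simp only [Fin.val_rev]; omega
  have r2 : (⟨n+4, by omega⟩ : Fin (2*n+4)).rev = ⟨n-1, by omega⟩ := by
    ext; simp only [Fin.val_rev]; omega
  simp only [Pi.zero_apply, r1, r2, zero_add] at e2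
  have hn0 : u ⟨n, by omega⟩ = 0 := by
    rw [← e1] at e2
    have : 2 * u ⟨n, by omega⟩ = 0 := by rw [two_mul]; exact e2.symm
    simpa using this
  have hlow : ∀ k (hk : k < n), u ⟨k, by omega⟩ = 0 := by
    intro k hk
    rcases Nat.lt_or_ge (k+1) n with h' | h'
    · have := row_mid n hn κ hκ heq u k h'
      rw [h, hn0] at this
      simpa using this.symm
    · have hk' : k = n - 1 := by omega
      subst hk'
      rw [← e1, hn0]
  have hc : i < n ∨ i = n ∨ i = n+1 := by omega
  rcases hc with hc | rfl | rfl
  · exact hlow i hc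
  · exact hn0
  · have := row_zero n hn κ hκ heq u
    rw [h, hlow 0 (by omega)] at this
    simpa using this.symm

theorem ker_sq (n : ℕ) (hn : 1 ≤ n) (κ : ℝ) (hκ : κ ∈ Set.Ioo (0 : ℝ) (1/2))
    (heq : (2 + 2*κ)^n * κ = 1) (v : Fin (2*n+4) → ℂ)
    (h : Amat n κ *ᵥ (Amat n κ *ᵥ v) = 0) : Amat n κ *ᵥ v = 0 := by
  funext i
  rcases Nat.lt_or_ge i (n+2) with hi | hi
  · exact ker_half n hn κ hκ heq v h i hi
  · have h1 : (fun j : Fin (2*n+4) => (Amat n κ *ᵥ v) j.rev) = Amat n κ *ᵥ (fun j => v j.rev) := by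
      funext k
      exact Amat_mulVec_rev n hn κ hκ heq v k
    have h2 : Amat n κ *ᵥ (Amat n κ *ᵥ (fun j => v j.rev)) = 0 := by
      rw [← h1]
      funext k
      rw [← Amat_mulVec_rev n hn κ hκ heq, h]; rfl
    have h3 := ker_half n hn κ hκ heq _ h2 (2*n+3-i) (by omega)
    rw [← h1] at h3
    have r : (⟨2*n+3-i, by omega⟩ : Fin (2*n+4)).rev = i := by
      ext; simp only [Fin.val_rev]; omega
    simp only [r] at h3
    exact h3

theorem ker_sq_mat (n : ℕ) (hn : 1 ≤ n) (κ : ℝ) (hκ : κ ∈ Set.Ioo (0 : ℝ) (1/2))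
    (heq : (2 + 2*κ)^n * κ = 1) (B : Matrix (Fin (2*n+4)) (Fin (2*n+4)) ℂ)
    (h : Amat n κ * (Amat n κ * B) = 0) : Amat n κ * B = 0 := by
  ext i j
  have := ker_sq n hn κ hκ heq (B *ᵥ Pi.single j 1) (by
    rw [Matrix.mulVec_mulVec, Matrix.mulVec_mulVec, Matrix.mul_assoc, h, Matrix.zero_mulVec])
  rw [Matrix.mulVec_mulVec] at this
  have h2 := congrFun this i
  simpa using h2

/-! ### Eigenvectors -/

/-- Eigenvector equations for the top half of the rows. -/
def TopEig (n : ℕ) (μ : ℂ) (W : ℕ → ℂ) : Prop :=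
  W 0 + W (n+1) = μ * W 0 ∧ (∀ i, i + 1 < n → W i + W n = μ * W (i+1)) ∧
  μ * W (n-1) = μ * W n ∧ μ * W (n-1) + (W (n+3) + W (n+4)) = μ * W (n+1)

theorem top_eig (n : ℕ) (hn : 1 ≤ n) (κ : ℝ) (hκ : κ ∈ Set.Ioo (0 : ℝ) (1/2))
    (heq : (2 + 2*κ)^n * κ = 1) (μ : ℂ) (W : ℕ → ℂ) (hW : TopEig n μ W)
    (i : ℕ) (hi : i < n + 2) :
    (Amat n κ *ᵥ (fun j : Fin (2*n+4) => W j)) ⟨i, by omega⟩ = μ * W i := by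
  obtain ⟨h0, h1, h2, h3⟩ := hW
  have hlow : ∀ k (hk : k < n),
      (Amat n κ *ᵥ (fun j : Fin (2*n+4) => W j)) ⟨k, by omega⟩ = μ * W k := by
    intro k hk
    rcases k with _ | k
    · rw [row_zero n hn κ hκ heq]; exact h0
    · rw [row_mid n hn κ hκ heq _ k hk]; exact h1 k hk
  have hc : i < n ∨ i = n ∨ i = n+1 := by omega
  rcases hc with hc | rfl | rfl
  · exact hlow i hc
  · rw [row_n i hn κ hκ heq, hlow _ (by omega)]; exact h2
  · rw [row_n1 n hn κ hκ heq, hlow _ (by omega)]; exact h3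

theorem full_eig (n : ℕ) (hn : 1 ≤ n) (κ : ℝ) (hκ : κ ∈ Set.Ioo (0 : ℝ) (1/2))
    (heq : (2 + 2*κ)^n * κ = 1) (μ : ℂ) (W : ℕ → ℂ) (hW : TopEig n μ W)
    (hW' : TopEig n μ (fun k => W (2*n+3-k))) :
    Amat n κ *ᵥ (fun j : Fin (2*n+4) => W j) = μ • (fun j : Fin (2*n+4) => W j) := by
  funext i
  rw [Pi.smul_apply, smul_eq_mul]
  rcases Nat.lt_or_ge i (n+2) with hi | hi
  · exact top_eig n hn κ hκ heq μ W hW i hi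
  · have h3 := top_eig n hn κ hκ heq μ _ hW' (2*n+3-i) (by omega)
    have h1 : (fun j : Fin (2*n+4) => W (2*n+3-j)) =
        (fun j : Fin (2*n+4) => (fun k : Fin (2*n+4) => W k) j.rev) := by
      funext j
      simp only [Fin.val_rev]
      congr 1
      omega
    rw [h1, ← Amat_mulVec_rev n hn κ hκ heq (fun k : Fin (2*n+4) => W k)] at h3
    have r : (⟨2*n+3-i, by omega⟩ : Fin (2*n+4)).rev = i := by
      ext; simp only [Fin.val_rev]; omega
    rw [r] at h3
    rw [h3, show 2*n+3-(2*n+3-(i:ℕ)) = i by omega]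

theorem exists_eig (n : ℕ) (hn : 1 ≤ n) (κ : ℝ) (hκ : κ ∈ Set.Ioo (0 : ℝ) (1/2))
    (heq : (2 + 2*κ)^n * κ = 1) (μ ε : ℂ) (hμ : μ ≠ 0) (hμ1 : μ ≠ 1) (hε : ε^2 = 1)
    (hroot : μ^(n+1) - 2*μ^n = 2*ε) :
    ∃ v : Fin (2*n+4) → ℂ, v ≠ 0 ∧ Amat n κ *ᵥ v = μ • v := by
  let V : ℕ → ℂ := fun i =>
    if i < n then μ*(μ^(n-i) - 2*μ^(n-1-i) + 1)
    else if i = n then μ*(μ-1) else (μ+2*ε)*(μ-1)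
  let W : ℕ → ℂ := fun i => if i < n+2 then V i else ε * V (2*n+3-i)
  have w0 : W 0 = μ*(μ^n - 2*μ^(n-1) + 1) := by
    simp only [W, V]; rw [if_pos (by omega), if_pos (by omega)]; simp
  have wl : ∀ i, i < n → W i = μ*(μ^(n-i) - 2*μ^(n-1-i) + 1) := by
    intro i hi
    simp only [W, V]; rw [if_pos (by omega), if_pos (by omega)]
  have wn : W n = μ*(μ-1) := by
    simp only [W, V]; rw [if_pos (by omega), if_neg (by omega)]; simp
  have wnm : W (n-1) = μ*(μ-1) := by
    rw [wl _ (by omega), show n-(n-1) = 1 by omega, show n-1-(n-1) = 0 by omega]; ring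
  have wn1 : W (n+1) = (μ+2*ε)*(μ-1) := by
    simp only [W, V]; rw [if_pos (by omega), if_neg (by omega), if_neg (by omega)]
  have wrev : ∀ k, k < 2*n+4 → W (2*n+3-k) = ε * W k := by
    intro k hk
    simp only [W]
    by_cases h : k < n + 2
    · rw [if_neg (by omega), if_pos h, show 2*n+3-(2*n+3-k) = k by omega]
    · rw [if_pos (by omega), if_neg h, ← mul_assoc, ← sq, hε, one_mul]
  have wn3 : W (n+3) = ε * (μ*(μ-1)) := by
    have := wrev n (by omega)
    rwa [show 2*n+3-n = n+3 by omega, wn] at this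
  have wn4 : W (n+4) = ε * (μ*(μ-1)) := by
    have := wrev (n-1) (by omega)
    rwa [show 2*n+3-(n-1) = n+4 by omega, wnm] at this
  have hT : TopEig n μ W := by
    refine ⟨?_, ?_, ?_, ?_⟩
    · rw [w0, wn1]
      obtain ⟨m, rfl⟩ : ∃ m, n = m + 1 := ⟨n-1, by omega⟩
      rw [Nat.add_sub_cancel]
      linear_combination (-(μ-1)) * hroot
    · intro i hi
      rw [wl i (by omega), wl (i+1) hi, wn]
      obtain ⟨m, rfl⟩ : ∃ m, n = i + 2 + m := ⟨n-i-2, by omega⟩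
      rw [show i+2+m-i = m+2 by omega, show i+2+m-1-i = m+1 by omega,
        show i+2+m-(i+1) = m+1 by omega, show i+2+m-1-(i+1) = m by omega]
      ring
    · rw [wnm, wn]
    · rw [wnm, wn3, wn4, wn1]; ring
  have hT' : TopEig n μ (fun k => W (2*n+3-k)) := by
    obtain ⟨h0, h1, h2, h3⟩ := hT
    refine ⟨?_, ?_, ?_, ?_⟩
    · simp only [wrev 0 (by omega), wrev (n+1) (by omega)]
      linear_combination ε * h0
    · intro i hi
      simp only [wrev i (by omega), wrev (i+1) (by omega), wrev n (by omega)]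
      linear_combination ε * h1 i hi
    · simp only [wrev (n-1) (by omega), wrev n (by omega)]
      linear_combination ε * h2
    · simp only [wrev (n-1) (by omega), wrev (n+1) (by omega), wrev (n+3) (by omega),
        wrev (n+4) (by omega)]
      linear_combination ε * h3
  refine ⟨fun j => W j, ?_, full_eig n hn κ hκ heq μ W hT hT'⟩
  intro h
  have := congrFun h ⟨n, by omega⟩
  simp only [wn, Pi.zero_apply, mul_eq_zero, sub_eq_zero] at this
  tauto

theorem exists_ker (n : ℕ) (hn : 1 ≤ n) (κ : ℝ) (hκ : κ ∈ Set.Ioo (0 : ℝ) (1/2))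
    (heq : (2 + 2*κ)^n * κ = 1) :
    ∃ v : Fin (2*n+4) → ℂ, v ≠ 0 ∧ Amat n κ *ᵥ v = (0:ℂ) • v := by
  let W : ℕ → ℂ := fun i => if i < n then 1 else if i < n+2 then -1 else 0
  have wl : ∀ i, i < n → W i = 1 := fun i hi => by simp only [W]; rw [if_pos hi]
  have wm : ∀ i, n ≤ i → i < n+2 → W i = -1 := fun i hi hi' => by
    simp only [W]; rw [if_neg (by omega), if_pos hi']
  have wr : ∀ i, n+2 ≤ i → W i = 0 := fun i hi => by
    simp only [W]; rw [if_neg (by omega), if_neg (by omega)]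
  refine ⟨fun j => W j, ?_, full_eig n hn κ hκ heq 0 W ?_ ?_⟩
  · intro h
    have := congrFun h ⟨0, by omega⟩
    simp [wl 0 (by omega)] at this
  · refine ⟨?_, ?_, ?_, ?_⟩
    · rw [wl 0 (by omega), wm (n+1) (by omega) (by omega)]; ring
    · intro i hi
      rw [wl i (by omega), wm n (by omega) (by omega)]; ring
    · ring
    · rw [wr (n+3) (by omega), wr (n+4) (by omega)]; ring
  · refine ⟨?_, ?_, ?_, ?_⟩
    · simp only [wr (2*n+3-0) (by omega), wr (2*n+3-(n+1)) (by omega)]; ring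
    · intro i hi
      simp only [wr (2*n+3-i) (by omega), wr (2*n+3-n) (by omega)]; ring
    · ring
    · simp only [wm (2*n+3-(n+3)) (by omega) (by omega), wl (2*n+3-(n+4)) (by omega)]; ring

/-! ### The trace -/

theorem Amat_trace (n : ℕ) (hn : 1 ≤ n) (κ : ℝ) (hκ : κ ∈ Set.Ioo (0 : ℝ) (1/2))
    (heq : (2 + 2*κ)^n * κ = 1) : (Amat n κ).trace = 4 := by
  classical
  unfold Matrix.trace
  simp only [Matrix.diag_apply, Amat_apply n hn κ hκ heq]
  let c : ℕ := if n = 1 then n+1 else n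
  have hc : (n = 1 ∧ c = n + 1) ∨ (n ≠ 1 ∧ c = n) := by
    simp only [c]; split_ifs <;> omega
  have key : ∀ i : Fin (2*n+4), (if fullRow n i i then (1:ℂ) else 0) =
      (if ((i:ℕ) = 0 ∨ (i:ℕ) = c) then 1 else 0) * 1
      + (if ((i:ℕ) = 2*n+3 ∨ (i:ℕ) = 2*n+3-c) then 1 else 0) * 1 := by
    intro i
    have h1 : fullRow n i i ↔
        (((i:ℕ) = 0 ∨ (i:ℕ) = c) ∨ ((i:ℕ) = 2*n+3 ∨ (i:ℕ) = 2*n+3-c)) := by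
      unfold fullRow halfRow topRow
      have := i.2
      by_cases h : (i:ℕ) < n + 2
      · rw [if_pos h]; omega
      · rw [if_neg h]; omega
    have h2 : ¬ (((i:ℕ) = 0 ∨ (i:ℕ) = c) ∧ ((i:ℕ) = 2*n+3 ∨ (i:ℕ) = 2*n+3-c)) := by omega
    simp only [h1]
    by_cases ha : ((i:ℕ) = 0 ∨ (i:ℕ) = c)
    · rw [if_pos (Or.inl ha), if_pos ha, if_neg (fun hb => h2 ⟨ha, hb⟩)]; ring
    · by_cases hb : ((i:ℕ) = 2*n+3 ∨ (i:ℕ) = 2*n+3-c)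
      · rw [if_pos (Or.inr hb), if_neg ha, if_pos hb]; ring
      · rw [if_neg (by tauto), if_neg ha, if_neg hb]; ring
  simp only [key]
  rw [Finset.sum_add_distrib]
  have s1 := sum_pair (2*n+4) 0 c (by omega) (by omega) (by omega) (fun i => i = 0 ∨ i = c)
      (fun j => Iff.rfl) (fun _ => 1)
  have s2 := sum_pair (2*n+4) (2*n+3) (2*n+3-c) (by omega) (by omega) (by omega)
      (fun i => i = 2*n+3 ∨ i = 2*n+3-c) (fun j => Iff.rfl) (fun _ => 1)
  have s3 : ((1:ℂ) + 1) + (1 + 1) = 4 := by norm_num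
  rw [← s3]
  congr 1
  · convert s1
  · convert s2

/-! ### The polynomial -/

theorem arith_ne (n : ℕ) (hn : 1 ≤ n) : (2*n)^n ≠ (n+1)^(n+1) := by
  intro h
  have h1 : n ∣ (n+1)^(n+1) := by
    rw [← h]
    exact dvd_pow (Dvd.intro_left 2 rfl) (by omega)
  have h2 : Nat.Coprime n ((n+1)^(n+1)) := by
    apply Nat.Coprime.pow_right
    simp
  have h3 : n = 1 := Nat.Coprime.eq_one_of_dvd h2 h1
  subst h3
  norm_num at h

open Polynomial in
/-- The claimed minimal polynomial. -/
noncomputable def minP (n : ℕ) : ℂ[X] :=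
  X ^ (2*n + 3) - C 4 * X ^ (2*n + 2) + C 4 * X ^ (2*n + 1) - C 4 * X

open Polynomial in
theorem minP_monic_deg (n : ℕ) : (minP n).Monic ∧ (minP n).natDegree = 2*n+3 := by
  have h : (minP n).natDegree = 2*n+3 := by
    unfold minP
    compute_degree!
    rw [if_neg (by omega)]
    decide
  refine ⟨?_, h⟩
  rw [Monic, leadingCoeff, h]
  unfold minP
  simp [coeff_X_pow]

open Polynomial in
theorem minP_coeff (n : ℕ) : (minP n).coeff (2*n+2) = -4 := by
  unfold minP
  simp [coeff_X_pow]

open Polynomial in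
theorem minP_nodup (n : ℕ) (hn : 1 ≤ n) : (minP n).roots.Nodup := by
  classical
  have h0 : minP n ≠ 0 := (minP_monic_deg n).1.ne_zero
  rw [Multiset.nodup_iff_count_le_one]
  intro μ
  rw [count_roots]
  by_contra hlt
  rw [not_le, one_lt_rootMultiplicity_iff_isRoot h0] at hlt
  obtain ⟨h1, h2⟩ := hlt
  unfold minP at h1 h2
  simp only [IsRoot.def, eval_sub, eval_add, eval_mul, eval_pow, eval_X, eval_C, derivative_sub,
    derivative_add, derivative_mul, derivative_X_pow, derivative_C, derivative_X, eval_zero,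
    eval_one] at h1 h2
  obtain ⟨m, rfl⟩ : ∃ m, n = m + 1 := ⟨n-1, by omega⟩
  simp only [show 2*(m+1)+3-1 = 2*m+4 by omega, show 2*(m+1)+2-1 = 2*m+3 by omega,
    show 2*(m+1)+1-1 = 2*m+2 by omega] at h2
  push_cast at h2
  have hμ : μ ≠ 0 := by
    rintro rfl
    simp at h2
  have hs : (μ^(m+1)*(μ-2))^2 = 4 := by
    apply mul_left_cancel₀ hμ
    linear_combination h1
  have hd : μ * (2 * (μ^(m+1)*(μ-2)) * (μ^m * ((m+2)*μ - 2*(m+1)))) = 0 := by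
    linear_combination h2 - hs
  have hs0 : μ^(m+1)*(μ-2) ≠ 0 := by
    intro h; rw [h] at hs; norm_num at hs
  have hr : ((m:ℂ)+2)*μ = 2*(m+1) := by
    have : ((m:ℂ)+2)*μ - 2*(m+1) = 0 := by
      simpa [hμ, hs0, sub_eq_zero] using hd
    linear_combination this
  have hm2 : ((m:ℂ)+2) ≠ 0 := by exact_mod_cast (by omega : m + 2 ≠ 0)
  have hfin : (((2*(m+1):ℕ):ℂ)^(m+1))^2 = (((m+2:ℕ):ℂ)^(m+2))^2 := by
    push_cast
    have e1 : ((m:ℂ)+2)*(μ-2) = -2 := by linear_combination hr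
    have e2 : (((m:ℂ)+2)*(μ-2))^2 * ((((m:ℂ)+2)*μ)^(m+1))^2 = 4 * (((m:ℂ)+2)^(m+2))^2 := by
      rw [mul_pow ((m:ℂ)+2) μ]
      linear_combination (((m:ℂ)+2)^(m+2))^2 * hs
    rw [e1, hr] at e2
    linear_combination e2/4
  have hfin' : ((2*(m+1))^(m+1))^2 = ((m+2)^(m+2))^2 := by exact_mod_cast hfin
  exact arith_ne (m+1) (by omega) (Nat.pow_left_injective (n := 2) (by norm_num) hfin')

open Polynomial in
theorem root_of_eig (N : ℕ) (A : Matrix (Fin N) (Fin N) ℂ) (μ : ℂ)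
    (h : ∃ v : Fin N → ℂ, v ≠ 0 ∧ A *ᵥ v = μ • v) : (minpoly ℂ A).IsRoot μ := by
  obtain ⟨v, hv, hA⟩ := h
  rw [← Matrix.minpoly_toLin']
  apply Module.End.isRoot_of_hasEigenvalue
  apply Module.End.hasEigenvalue_of_hasEigenvector (x := v)
  refine ⟨Module.End.mem_eigenspace_iff.mpr ?_, hv⟩
  rw [Matrix.toLin'_apply, hA]

open Polynomial in
theorem minP_dvd (n : ℕ) (hn : 1 ≤ n) (κ : ℝ) (hκ : κ ∈ Set.Ioo (0 : ℝ) (1/2))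
    (heq : (2 + 2*κ)^n * κ = 1) : minP n ∣ minpoly ℂ (Amat n κ) := by
  have hP0 : minP n ≠ 0 := (minP_monic_deg n).1.ne_zero
  have hM0 : minpoly ℂ (Amat n κ) ≠ 0 := minpoly.ne_zero (Matrix.isIntegral _)
  apply (IsAlgClosed.splits (minP n)).dvd_of_roots_le_roots hP0
  rw [Multiset.le_iff_subset (minP_nodup n hn)]
  intro μ hμ
  rw [mem_roots hP0] at hμ
  rw [mem_roots hM0]
  apply root_of_eig
  by_cases h0 : μ = 0
  · subst h0
    exact exists_ker n hn κ hκ heq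
  · unfold minP at hμ
    simp only [IsRoot.def, eval_sub, eval_add, eval_mul, eval_pow, eval_X, eval_C] at hμ
    have hs : (μ^(n+1) - 2*μ^n)^2 = 4 := by
      apply mul_left_cancel₀ h0
      linear_combination hμ
    refine exists_eig n hn κ hκ heq μ ((μ^(n+1) - 2*μ^n)/2) h0 ?_ ?_ ?_
    · rintro rfl
      norm_num at hs
    · linear_combination hs/4
    · ring

open Polynomial in
theorem charpoly_eq (n : ℕ) (hn : 1 ≤ n) (κ : ℝ) (hκ : κ ∈ Set.Ioo (0 : ℝ) (1/2))
    (heq : (2 + 2*κ)^n * κ = 1) : (Amat n κ).charpoly = minP n * X := by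
  obtain ⟨hPm, hPd⟩ := minP_monic_deg n
  have hd : minP n ∣ (Amat n κ).charpoly :=
    (minP_dvd n hn κ hκ heq).trans (minpoly.dvd _ _ (Matrix.aeval_self_charpoly _))
  obtain ⟨Q, hQ⟩ := hd
  have hCm := Matrix.charpoly_monic (Amat n κ)
  have hCd := Matrix.charpoly_natDegree_eq_dim (Amat n κ)
  rw [Fintype.card_fin] at hCd
  have hQm : Q.Monic := hPm.of_mul_monic_left (hQ ▸ hCm)
  have hQd : Q.natDegree = 1 := by
    rw [hQ, hPm.natDegree_mul hQm, hPd] at hCd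
    omega
  have hQe := hQm.eq_X_add_C hQd
  have : Nonempty (Fin (2*n+4)) := ⟨⟨0, by omega⟩⟩
  have ht := Matrix.trace_eq_neg_charpoly_coeff (Amat n κ)
  rw [Amat_trace n hn κ hκ heq, Fintype.card_fin, hQ, hQe,
    show 2*n+4-1 = (2*n+2)+1 by omega, mul_add, coeff_add, coeff_mul_X, minP_coeff, coeff_mul_C,
    show 2*n+2+1 = (minP n).natDegree by omega, hPm.coeff_natDegree] at ht
  have hc : Q.coeff 0 = 0 := by linear_combination ht
  rw [hQ, hQe, hc, C_0, add_zero]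

open Polynomial in
theorem minpoly_eq (n : ℕ) (hn : 1 ≤ n) (κ : ℝ) (hκ : κ ∈ Set.Ioo (0 : ℝ) (1/2))
    (heq : (2 + 2*κ)^n * κ = 1) : minpoly ℂ (Amat n κ) = minP n := by
  apply eq_of_monic_of_associated (minpoly.monic (Matrix.isIntegral _)) (minP_monic_deg n).1
  apply associated_of_dvd_dvd _ (minP_dvd n hn κ hκ heq)
  apply minpoly.dvd
  have hX : minP n = X * (X ^ (2*n + 2) - C 4 * X ^ (2*n + 1) + C 4 * X ^ (2*n) - C 4) := by
    unfold minP; ring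
  have hCH := Matrix.aeval_self_charpoly (Amat n κ)
  rw [charpoly_eq n hn κ hκ heq, mul_comm (minP n) X, hX, map_mul, map_mul, aeval_X] at hCH
  rw [hX, map_mul, aeval_X]
  exact ker_sq_mat n hn κ hκ heq _ hCH

open Polynomial in
/-- For every `n ≥ 1`, the minimal polynomial of `A_n` is
`X^{2n+3} - 4X^{2n+2} + 4X^{2n+1} - 4X = X (X^{n+1} - 2X^n - 2)(X^{n+1} - 2X^n + 2)`,
and the characteristic polynomial of `A_n` is `X` times the minimal polynomial. -/
theorem Amat_minpoly_charpoly (n : ℕ) (hn : 1 ≤ n) (κ : ℝ)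
    (hκ : κ ∈ Set.Ioo (0 : ℝ) (1/2)) (heq : (2 + 2*κ)^n * κ = 1) :
    minpoly ℂ (Amat n κ) =
      X ^ (2*n + 3) - C 4 * X ^ (2*n + 2) + C 4 * X ^ (2*n + 1) - C 4 * X ∧
    (Amat n κ).charpoly =
      X ^ (2*n + 4) - C 4 * X ^ (2*n + 3) + C 4 * X ^ (2*n + 2) - C 4 * X ^ 2 := by
  refine ⟨minpoly_eq n hn κ hκ heq, ?_⟩
  rw [charpoly_eq n hn κ hκ heq]
  unfold minP
  ring
end

section
/- For every integer n ≥ 2: the minimal polynomial of the complex matrix B_n is X^{n+2} − 2X^{n+1} − 2X (which factors as X·(X^{n+1} − 2X^n − 2)), the characteristic polynomial of B_n is X^{n+3} − 2X^{n+2} − 2X² (i.e., X²·(X^{n+1} − 2X^n − 2)), and B_n is diagonalizable over ℂ (there exist an invertible matrix P and a diagonal matrix D with B_n = P D P^{−1}). -/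
open Matrix

/-- The factor map `T̃_κ : [0,1] → [0,1]`, `T̃_κ(x) = |T_κ(x)|`. -/
noncomputable def factorTent (κ : ℝ) (x : ℝ) : ℝ := |pairedTent κ x|

/-- The partition points `q_0 < q_1 < ⋯ < q_{n+3}` of the Markov partition for `T̃_n`
(`n ≥ 2`): `q_0 = 0`, `q_1 = κ`, `q_2 = 1/2 - κ/(2(1+κ))`, `q_3 = 1/2`,
`q_{3+i} = 1 - (2+2κ)^{n-i} κ` for `1 ≤ i ≤ n-1`, and `q_{n+3} = 1`. -/
noncomputable def factorPoint (n : ℕ) (κ : ℝ) (i : ℕ) : ℝ :=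
  if i = 0 then 0
  else if i = 1 then κ
  else if i = 2 then 1/2 - κ/(2*(1+κ))
  else if i = 3 then 1/2
  else if i < n + 3 then 1 - (2 + 2*κ)^(n + 3 - i) * κ
  else 1

/-- The interval `S_i = (q_{i-1}, q_i)`, for `1 ≤ i ≤ n+3`. -/
noncomputable def factorInterval (n : ℕ) (κ : ℝ) (i : ℕ) : Set ℝ :=
  Set.Ioo (factorPoint n κ (i - 1)) (factorPoint n κ i)

open scoped Classical in
/-- The `(n+3) × (n+3)` adjacency matrix `B_n`: the `(i,j)` entry (1-based) is `1`
if `S_i ⊆ T̃_n(S_j)` and `0` otherwise. -/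
noncomputable def Bmat (n : ℕ) (κ : ℝ) : Matrix (Fin (n + 3)) (Fin (n + 3)) ℂ :=
  Matrix.of fun i j =>
    if factorInterval n κ ((i : ℕ) + 1) ⊆ factorTent κ '' factorInterval n κ ((j : ℕ) + 1)
    then 1 else 0


/-! ## Intervals and images -/

lemma image_affine_pos {f : ℝ → ℝ} {a b c d a' b' : ℝ} (hc : 0 < c)
    (hf : ∀ x ∈ Set.Ioo a b, f x = c * x + d) (ha : c * a + d = a') (hb : c * b + d = b') :
    f '' Set.Ioo a b = Set.Ioo a' b' := by
  subst ha hb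
  ext y
  constructor
  · rintro ⟨x, hx, rfl⟩
    rw [hf x hx]
    exact ⟨by nlinarith [hx.1], by nlinarith [hx.2]⟩
  · rintro ⟨h1, h2⟩
    have hx : (y - d) / c ∈ Set.Ioo a b := by
      constructor
      · rw [lt_div_iff₀ hc]; linarith
      · rw [div_lt_iff₀ hc]; linarith
    refine ⟨(y - d) / c, hx, ?_⟩
    rw [hf _ hx]; field_simp; ring

lemma image_affine_neg {f : ℝ → ℝ} {a b c d a' b' : ℝ} (hc : 0 < c)
    (hf : ∀ x ∈ Set.Ioo a b, f x = d - c * x) (ha : d - c * a = b') (hb : d - c * b = a') :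
    f '' Set.Ioo a b = Set.Ioo a' b' := by
  subst ha hb
  ext y
  constructor
  · rintro ⟨x, hx, rfl⟩
    rw [hf x hx]
    exact ⟨by nlinarith [hx.2], by nlinarith [hx.1]⟩
  · rintro ⟨h1, h2⟩
    have hx : (d - y) / c ∈ Set.Ioo a b := by
      constructor
      · rw [lt_div_iff₀ hc]; linarith
      · rw [div_lt_iff₀ hc]; linarith
    refine ⟨(d - y) / c, hx, ?_⟩
    rw [hf _ hx]; field_simp; ring

/-- index of the left end of the image of the `j`-th interval (0-based) -/
def loIdx (n j : ℕ) : ℕ :=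
  if j = 0 then n + 2 else if j ≤ 4 then 0 else j - 1

/-- index of the right end of the image of the `j`-th interval (0-based) -/
def hiIdx (n j : ℕ) : ℕ :=
  if j = 0 then n + 3 else if j = 1 then n + 2 else if j ≤ 3 then 1
  else if j = n + 2 then n + 3 else j

section
variable {n : ℕ} {κ : ℝ}

lemma fp_big (j : ℕ) (h : 4 ≤ j) (h' : j < n + 3) :
    factorPoint n κ j = 1 - (2 + 2*κ)^(n + 3 - j) * κ := by
  unfold factorPoint
  rw [if_neg (by omega), if_neg (by omega), if_neg (by omega), if_neg (by omega), if_pos h']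

lemma fp_last (hn : 2 ≤ n) : factorPoint n κ (n+3) = 1 := by
  unfold factorPoint
  rw [if_neg (by omega), if_neg (by omega), if_neg (by omega), if_neg (by omega),
    if_neg (by omega)]
end

section
variable {n : ℕ} {κ : ℝ}

lemma kap_small (hn : 2 ≤ n) (h0 : 0 < κ) (heq : (2 + 2*κ)^n * κ = 1) :
    (2 + 2*κ)^2 * κ ≤ 1 := by
  rw [← heq]
  apply mul_le_mul_of_nonneg_right _ h0.le
  exact pow_le_pow_right₀ (by linarith) hn

lemma fp_two (h0 : 0 < κ) : factorPoint n κ 2 = 1 / (2 + 2*κ) := by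
  unfold factorPoint
  simp
  field_simp
  ring

lemma fp_four (hn : 2 ≤ n) (h0 : 0 < κ) (heq : (2 + 2*κ)^n * κ = 1) :
    factorPoint n κ 4 = 1 - 1 / (2 + 2*κ) := by
  rw [fp_big 4 le_rfl (by omega)]
  obtain ⟨m, rfl⟩ : ∃ m, n = m + 1 := ⟨n - 1, by omega⟩
  rw [show m + 1 + 3 - 4 = m by omega]
  congr 1
  rw [eq_div_iff (by positivity), ← heq]
  ring

lemma fp_lt_succ (hn : 2 ≤ n) (h0 : 0 < κ) (heq : (2 + 2*κ)^n * κ = 1) (j : ℕ) (hj : j < n + 3) :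
    factorPoint n κ j < factorPoint n κ (j + 1) := by
  have hs := kap_small hn h0 heq
  have hl : 0 < 2 + 2*κ := by linarith
  have h2 := fp_two (n := n) h0
  have h4 := fp_four hn h0 heq
  have hhalf : 1 / (2 + 2*κ) < 1/2 := by
    rw [div_lt_div_iff₀ hl (by norm_num)]; linarith
  have e0 : factorPoint n κ 0 = 0 := by simp [factorPoint]
  have e1 : factorPoint n κ 1 = κ := by simp [factorPoint]
  have e3 : factorPoint n κ 3 = 1/2 := by simp [factorPoint]
  rcases Nat.lt_or_ge j 4 with h | h
  · interval_cases j
    · rw [e0, e1]; exact h0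
    · rw [e1, h2, lt_div_iff₀ hl]; nlinarith
    · rw [h2, e3]; exact hhalf
    · rw [e3, h4]; linarith
  · rw [fp_big j h hj]
    rcases Nat.lt_or_ge (j+1) (n+3) with h' | h'
    · rw [fp_big (j+1) (by omega) h']
      have : (2 + 2*κ)^(n + 3 - (j+1)) < (2 + 2*κ)^(n + 3 - j) :=
        pow_lt_pow_right₀ (by linarith) (by omega)
      nlinarith
    · rw [show j + 1 = n + 3 by omega, fp_last hn]
      have : 0 < (2 + 2*κ)^(n + 3 - j) * κ := by positivity
      linarith

lemma fp_lt (hn : 2 ≤ n) (h0 : 0 < κ) (heq : (2 + 2*κ)^n * κ = 1) {i j : ℕ} (hij : i < j)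
    (hj : j ≤ n + 3) : factorPoint n κ i < factorPoint n κ j := by
  induction j, hij using Nat.le_induction with
  | base => exact fp_lt_succ hn h0 heq i (by omega)
  | succ k hk ih => exact (ih (by omega)).trans (fp_lt_succ hn h0 heq k (by omega))

lemma fp_le_iff (hn : 2 ≤ n) (h0 : 0 < κ) (heq : (2 + 2*κ)^n * κ = 1) {i j : ℕ}
    (hi : i ≤ n + 3) (hj : j ≤ n + 3) : factorPoint n κ i ≤ factorPoint n κ j ↔ i ≤ j := by
  constructor
  · intro h
    by_contra hc
    exact absurd (fp_lt hn h0 heq (not_le.mp hc) hi) (not_lt.mpr h)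
  · intro h
    rcases h.eq_or_lt with rfl | h
    · exact le_rfl
    · exact (fp_lt hn h0 heq h hj).le

lemma image_interval (hn : 2 ≤ n) (h0 : 0 < κ) (heq : (2 + 2*κ)^n * κ = 1)
    (j : ℕ) (hj : j < n + 3) :
    factorTent κ '' Set.Ioo (factorPoint n κ j) (factorPoint n κ (j+1)) =
      Set.Ioo (factorPoint n κ (loIdx n j)) (factorPoint n κ (hiIdx n j)) := by
  have hs := kap_small hn h0 heq
  have hl : 0 < 2 + 2*κ := by linarith
  have h2 := fp_two (n := n) h0
  have h4 := fp_four hn h0 heq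
  have hhalf : 1 / (2 + 2*κ) < 1/2 := by
    rw [div_lt_div_iff₀ hl (by norm_num)]; linarith
  have hinv : (2 + 2*κ) * (1 / (2 + 2*κ)) = 1 := by field_simp
  have e0 : factorPoint n κ 0 = 0 := by simp [factorPoint]
  have e1 : factorPoint n κ 1 = κ := by simp [factorPoint]
  have e3 : factorPoint n κ 3 = 1/2 := by simp [factorPoint]
  have en2 : factorPoint n κ (n+2) = 1 - (2 + 2*κ) * κ := by
    rw [fp_big (n+2) (by omega) (by omega), show n + 3 - (n+2) = 1 by omega, pow_one]
  have k1 : κ < 1 / (2 + 2*κ) := by rw [lt_div_iff₀ hl]; nlinarith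
  -- formulas on the branches
  have L1 : ∀ x, 0 < x → x ≤ 1 / (2 + 2*κ) → factorTent κ x = 1 - (2 + 2*κ) * x := by
    intro x hx hx'
    have : (2 + 2*κ) * x ≤ 1 := by rw [← hinv]; gcongr
    unfold factorTent pairedTent
    rw [if_neg (by linarith), if_neg (by linarith), if_neg (by linarith), if_pos (by linarith),
      abs_of_nonneg (by linarith)]
    ring
  have L2 : ∀ x, 1 / (2 + 2*κ) ≤ x → x ≤ 1/2 → factorTent κ x = (2 + 2*κ) * x + (-1) := by
    intro x hx hx'
    have hp : 0 < 1 / (2 + 2*κ) := by positivity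
    have : 1 ≤ (2 + 2*κ) * x := by rw [← hinv]; gcongr
    unfold factorTent pairedTent
    rw [if_neg (by linarith), if_neg (by linarith), if_neg (by linarith), if_pos (by linarith),
      abs_of_nonpos (by linarith)]
    ring
  have L3 : ∀ x, 1/2 < x → x ≤ 1 - 1 / (2 + 2*κ) →
      factorTent κ x = (1 + 2*κ) - (2 + 2*κ) * x := by
    intro x hx hx'
    have : (2 + 2*κ) * x ≤ (2 + 2*κ) * (1 - 1 / (2 + 2*κ)) := by gcongr
    rw [mul_sub, hinv] at this
    unfold factorTent pairedTent
    rw [if_neg (by linarith), if_neg (by linarith), if_neg (by linarith), if_neg (by linarith),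
      abs_of_nonpos (by linarith)]
    ring
  have L4 : ∀ x, 1 - 1 / (2 + 2*κ) ≤ x → factorTent κ x = (2 + 2*κ) * x + (-(1 + 2*κ)) := by
    intro x hx
    have : (2 + 2*κ) * (1 - 1 / (2 + 2*κ)) ≤ (2 + 2*κ) * x := by gcongr
    rw [mul_sub, hinv] at this
    unfold factorTent pairedTent
    rw [if_neg (by linarith), if_neg (by linarith), if_neg (by linarith), if_neg (by linarith),
      abs_of_nonneg (by linarith)]
    ring
  rcases Nat.lt_or_ge j 4 with h | h
  · interval_cases j
    · have : loIdx n 0 = n + 2 := rfl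
      have h' : hiIdx n 0 = n + 3 := rfl
      rw [this, h', e0, e1, en2, fp_last hn]
      refine image_affine_neg (d := 1) hl (fun x hx => L1 x hx.1 (hx.2.le.trans k1.le)) ?_ ?_
      · ring
      · ring
    · have : loIdx n 1 = 0 := rfl
      have h' : hiIdx n 1 = n + 2 := rfl
      rw [this, h', e0, e1, h2, en2]
      refine image_affine_neg (d := 1) hl (fun x hx => L1 x (h0.trans hx.1) hx.2.le) ?_ ?_
      · ring
      · linarith
    · have : loIdx n 2 = 0 := rfl
      have h' : hiIdx n 2 = 1 := rfl
      rw [this, h', e0, e1, e3, h2]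
      refine image_affine_pos (d := -1) hl (fun x hx => L2 x hx.1.le hx.2.le) ?_ ?_
      · linarith
      · ring
    · have : loIdx n 3 = 0 := rfl
      have h' : hiIdx n 3 = 1 := rfl
      rw [this, h', e0, e1, e3, h4]
      refine image_affine_neg (d := 1 + 2*κ) hl (fun x hx => L3 x hx.1 hx.2.le) ?_ ?_
      · ring
      · rw [mul_sub, hinv]; ring
  · have hq : factorPoint n κ 4 ≤ factorPoint n κ j :=
      (fp_le_iff hn h0 heq (by omega) (by omega)).2 h
    rw [h4] at hq
    refine image_affine_pos (d := -(1 + 2*κ)) hl (fun x hx => L4 x (hq.trans hx.1.le)) ?_ ?_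
    · rcases h.eq_or_lt with rfl | h
      · have : loIdx n 4 = 0 := rfl
        rw [this, e0, h4, mul_sub, hinv]; ring
      · have : loIdx n j = j - 1 := by unfold loIdx; split_ifs <;> omega
        rw [this, fp_big j (by omega) hj, fp_big (j-1) (by omega) (by omega),
          show n + 3 - (j-1) = (n + 3 - j) + 1 by omega, pow_succ]
        ring
    · rcases Nat.lt_or_ge (j+1) (n+3) with h' | h'
      · have : hiIdx n j = j := by unfold hiIdx; split_ifs <;> omega
        rw [this, fp_big j (by omega) hj, fp_big (j+1) (by omega) (by omega),
          show n + 3 - j = (n + 3 - (j+1)) + 1 by omega, pow_succ]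
        ring
      · have : hiIdx n j = n + 3 := by unfold hiIdx; split_ifs <;> omega
        rw [this, show j + 1 = n + 3 by omega, fp_last hn]
        ring

lemma Bmat_apply (hn : 2 ≤ n) (h0 : 0 < κ) (heq : (2 + 2*κ)^n * κ = 1) (i j : Fin (n+3)) :
    Bmat n κ i j = if loIdx n j ≤ (i : ℕ) ∧ (i : ℕ) < hiIdx n j then 1 else 0 := by
  have hj := j.2
  have hi := i.2
  have h1 : loIdx n j ≤ n + 3 := by unfold loIdx; split_ifs <;> omega
  have h2 : hiIdx n j ≤ n + 3 := by unfold hiIdx; split_ifs <;> omega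
  unfold Bmat factorInterval
  simp only [Matrix.of_apply]
  rw [Nat.add_sub_cancel, Nat.add_sub_cancel]
  rw [image_interval hn h0 heq j hj,
    Set.Ioo_subset_Ioo_iff (fp_lt_succ hn h0 heq i hi),
    fp_le_iff hn h0 heq h1 (by omega), fp_le_iff hn h0 heq (by omega) h2]
  simp only [Nat.succ_le_iff]

/-- indicator vector of the first `j` coordinates -/
def fvec (n j : ℕ) : Fin (n+3) → ℂ := fun i => if (i : ℕ) < j then 1 else 0

lemma fvec_succ (j : Fin (n+3)) : fvec n (j+1) = fvec n j + Pi.single j 1 := by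
  ext i
  simp only [fvec, Pi.add_apply, Pi.single_apply, Fin.ext_iff]
  split_ifs <;> first | omega | simp

lemma fvec_zero : fvec n 0 = 0 := by ext i; simp [fvec]

lemma Bmat_fvec_succ (hn : 2 ≤ n) (h0 : 0 < κ) (heq : (2 + 2*κ)^n * κ = 1) (j : ℕ)
    (hj : j < n + 3) : Bmat n κ *ᵥ fvec n (j+1) =
      Bmat n κ *ᵥ fvec n j + (fvec n (hiIdx n j) - fvec n (loIdx n j)) := by
  have := fvec_succ (⟨j, hj⟩ : Fin (n+3))
  simp only at this
  rw [this, Matrix.mulVec_add, Matrix.mulVec_single_one]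
  congr 1
  ext i
  simp only [Matrix.col_apply, Bmat_apply hn h0 heq, fvec, Pi.sub_apply]
  have hlh : loIdx n j ≤ hiIdx n j := by unfold loIdx hiIdx; split_ifs <;> omega
  split_ifs <;> first | omega | simp


lemma B_f1 (hn : 2 ≤ n) (h0 : 0 < κ) (heq : (2 + 2*κ)^n * κ = 1)
    : Bmat n κ *ᵥ fvec n 1 = fvec n (n+3) - fvec n (n+2) := by
  rw [Bmat_fvec_succ hn h0 heq 0 (by omega), fvec_zero, Matrix.mulVec_zero, zero_add]
  rfl

lemma B_f2 (hn : 2 ≤ n) (h0 : 0 < κ) (heq : (2 + 2*κ)^n * κ = 1)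
    : Bmat n κ *ᵥ fvec n 2 = fvec n (n+3) := by
  rw [Bmat_fvec_succ hn h0 heq 1 (by omega), B_f1 hn h0 heq,
    show hiIdx n 1 = n + 2 from rfl, show loIdx n 1 = 0 from rfl, fvec_zero]
  abel

lemma B_f3 (hn : 2 ≤ n) (h0 : 0 < κ) (heq : (2 + 2*κ)^n * κ = 1)
    : Bmat n κ *ᵥ fvec n 3 = fvec n (n+3) + fvec n 1 := by
  rw [Bmat_fvec_succ hn h0 heq 2 (by omega), B_f2 hn h0 heq,
    show hiIdx n 2 = 1 from rfl, show loIdx n 2 = 0 from rfl, fvec_zero, sub_zero]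

lemma B_f4 (hn : 2 ≤ n) (h0 : 0 < κ) (heq : (2 + 2*κ)^n * κ = 1)
    : Bmat n κ *ᵥ fvec n 4 = fvec n (n+3) + 2 • fvec n 1 := by
  rw [Bmat_fvec_succ hn h0 heq 3 (by omega), B_f3 hn h0 heq,
    show hiIdx n 3 = 1 from rfl, show loIdx n 3 = 0 from rfl, fvec_zero, sub_zero]
  abel

lemma B_fj (hn : 2 ≤ n) (h0 : 0 < κ) (heq : (2 + 2*κ)^n * κ = 1)
    (j : ℕ) (hj : 4 ≤ j) (hj' : j + 1 ≤ n + 2) :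
    Bmat n κ *ᵥ fvec n (j+1) = fvec n (n+3) + 2 • fvec n 1 + fvec n j := by
  induction j, hj using Nat.le_induction with
  | base =>
    have : hiIdx n 4 = 4 := by unfold hiIdx; grind
    rw [Bmat_fvec_succ hn h0 heq 4 (by omega), B_f4 hn h0 heq, this,
      show loIdx n 4 = 0 from rfl, fvec_zero, sub_zero]
  | succ k hk ih =>
    have h1 : hiIdx n (k+1) = k+1 := by unfold hiIdx; grind
    have h2 : loIdx n (k+1) = k := by unfold loIdx; grind
    rw [Bmat_fvec_succ hn h0 heq (k+1) (by omega), ih (by omega), h1, h2]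
    abel

lemma B_F (hn : 2 ≤ n) (h0 : 0 < κ) (heq : (2 + 2*κ)^n * κ = 1)
    : Bmat n κ *ᵥ fvec n (n+3) = 2 • fvec n (n+3) + 2 • fvec n 1 := by
  rw [Bmat_fvec_succ hn h0 heq (n+2) (by omega)]
  have h1 : hiIdx n (n+2) = n+3 := by unfold hiIdx; grind
  rcases hn.eq_or_lt with rfl | hn'
  · rw [B_f4 le_rfl h0 heq, h1, show loIdx 2 (2+2) = 0 from rfl, fvec_zero]
    abel
  · have h2 : loIdx n (n+2) = n+1 := by unfold loIdx; grind
    rw [B_fj hn h0 heq (n+1) (by omega) le_rfl, h1, h2]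
    abel

/-- the cyclic chain -/
lemma chain (hn : 2 ≤ n) (h0 : 0 < κ) (heq : (2 + 2*κ)^n * κ = 1)
    (i : ℕ) (hi : i + 2 ≤ n) :
    ((Bmat n κ).mulVecLin ^ (i+1)) (fvec n 1) = fvec n (n+3) - fvec n (n+2-i) := by
  induction i with
  | zero => simpa using B_f1 hn h0 heq
  | succ k ih =>
    rw [pow_succ', Module.End.mul_apply, ih (by omega), Matrix.mulVecLin_apply,
      Matrix.mulVec_sub, B_F hn h0 heq]
    have : n + 2 - k = (n + 2 - (k+1)) + 1 := by omega
    rw [this, B_fj hn h0 heq _ (by omega) (by omega)]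
    abel

lemma chain_n (hn : 2 ≤ n) (h0 : 0 < κ) (heq : (2 + 2*κ)^n * κ = 1)
    : ((Bmat n κ).mulVecLin ^ n) (fvec n 1) = fvec n (n+3) := by
  obtain ⟨m, rfl⟩ : ∃ m, n = m + 2 := ⟨n - 2, by omega⟩
  rw [show m + 2 = (m + 1) + 1 by omega, pow_succ', Module.End.mul_apply]
  have := chain hn h0 heq m le_rfl
  rw [show m + 2 + 2 - m = 4 by omega] at this
  erw [this]
  rw [Matrix.mulVecLin_apply, Matrix.mulVec_sub]
  erw [B_F hn h0 heq, B_f4 hn h0 heq]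
  abel

lemma chain_succ (hn : 2 ≤ n) (h0 : 0 < κ) (heq : (2 + 2*κ)^n * κ = 1)
    : ((Bmat n κ).mulVecLin ^ (n+1)) (fvec n 1) =
    2 • fvec n (n+3) + 2 • fvec n 1 := by
  rw [pow_succ', Module.End.mul_apply, chain_n hn h0 heq, Matrix.mulVecLin_apply,
    B_F hn h0 heq]

lemma kerA (hn : 2 ≤ n) (h0 : 0 < κ) (heq : (2 + 2*κ)^n * κ = 1)
    : (Bmat n κ).mulVecLin (fvec n 2 - (fvec n (n+3) - fvec n 4)) = 0 := by
  rw [Matrix.mulVecLin_apply, Matrix.mulVec_sub, Matrix.mulVec_sub, B_f2 hn h0 heq,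
    B_F hn h0 heq, B_f4 hn h0 heq]
  abel

lemma kerB (hn : 2 ≤ n) (h0 : 0 < κ) (heq : (2 + 2*κ)^n * κ = 1)
    : (Bmat n κ).mulVecLin (fvec n 3 + fvec n 3 - fvec n (n+3)) = 0 := by
  rw [Matrix.mulVecLin_apply, Matrix.mulVec_sub, Matrix.mulVec_add, B_f3 hn h0 heq,
    B_F hn h0 heq]
  abel

lemma gen_top (hn : 2 ≤ n) (h0 : 0 < κ) (heq : (2 + 2*κ)^n * κ = 1)
    (W : Submodule ℂ (Fin (n+3) → ℂ)) (hW : ∀ w ∈ W, (Bmat n κ).mulVecLin w ∈ W)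
    (hu : fvec n 1 ∈ W) (ha : fvec n 2 - (fvec n (n+3) - fvec n 4) ∈ W)
    (hb : fvec n 3 + fvec n 3 - fvec n (n+3) ∈ W) : W = ⊤ := by
  have hpow : ∀ i : ℕ, ((Bmat n κ).mulVecLin ^ i) (fvec n 1) ∈ W := by
    intro i
    induction i with
    | zero => simpa using hu
    | succ k ih => rw [pow_succ', Module.End.mul_apply]; exact hW _ ih
  have hF : fvec n (n+3) ∈ W := chain_n hn h0 heq ▸ hpow n
  have hbig : ∀ j, 4 ≤ j → j ≤ n + 2 → fvec n j ∈ W := by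
    intro j h h'
    have := hpow (n + 2 - j + 1)
    rw [chain hn h0 heq _ (by omega), show n + 2 - (n + 2 - j) = j by omega] at this
    simpa using W.sub_mem hF this
  have h2 : fvec n 2 ∈ W := by
    have := W.add_mem ha (W.sub_mem hF (hbig 4 le_rfl (by omega)))
    simpa using this
  have h3 : fvec n 3 ∈ W := by
    have := W.smul_mem (1/2 : ℂ) (W.add_mem hb hF)
    rw [sub_add_cancel, ← two_smul ℂ, smul_smul] at this
    simpa using this
  have hall : ∀ j, j ≤ n + 3 → fvec n j ∈ W := by
    intro j hj
    rcases Nat.lt_or_ge j 4 with h | h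
    · interval_cases j
      · rw [fvec_zero]; exact W.zero_mem
      · exact hu
      · exact h2
      · exact h3
    · rcases hj.eq_or_lt with rfl | h'
      · exact hF
      · exact hbig j h (by omega)
  rw [eq_top_iff, ← (Pi.basisFun ℂ (Fin (n+3))).span_eq, Submodule.span_le]
  rintro _ ⟨j, rfl⟩
  have := W.sub_mem (hall (j+1) (by omega)) (hall j (by omega))
  rw [fvec_succ] at this
  simpa using this

end

open Polynomial in
lemma diag_core {N : ℕ} (B : Matrix (Fin N) (Fin N) ℂ) (p : ℂ[X]) (hp : p.Monic)
    (hsep : p.Separable) (hz : p.eval 0 ≠ 0) (hdeg : p.natDegree + 2 = N) (hd0 : 0 < p.natDegree)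
    (u a b : Fin N → ℂ) (hu : aeval B.mulVecLin p u = 0)
    (ha : B.mulVecLin a = 0) (hb : B.mulVecLin b = 0)
    (hgen : ∀ W : Submodule ℂ (Fin N → ℂ), (∀ w ∈ W, B.mulVecLin w ∈ W) → u ∈ W → a ∈ W →
      b ∈ W → W = ⊤) :
    minpoly ℂ B = X * p ∧ B.charpoly = X ^ 2 * p ∧
    (∃ P D : Matrix (Fin N) (Fin N) ℂ, IsUnit P ∧ D.IsDiag ∧ B = P * D * P⁻¹) := by
  classical
  set T := B.mulVecLin with hT
  set R : Finset ℂ := p.roots.toFinset with hR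
  have hval : R.val = p.roots := by
    rw [hR, Multiset.toFinset_val, (nodup_roots hsep).dedup]
  have hcard0 : Multiset.card p.roots = p.natDegree :=
    (IsAlgClosed.splits p).natDegree_eq_card_roots.symm
  have hcard : R.card = p.natDegree := by
    rw [Finset.card_def, hval, hcard0]
  have hprod : ∏ r ∈ R, (X - C r) = p := by
    rw [Finset.prod_eq_multiset_prod, hval]
    exact prod_multiset_X_sub_C_of_monic_of_roots_card_eq hp hcard0
  have hRne : R.Nonempty := by rw [← Finset.card_pos, hcard]; exact hd0
  -- eigenvectors
  let v : R ⊕ Fin 2 → (Fin N → ℂ) :=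
    Sum.elim (fun r => aeval T (Lagrange.basis R id (r : ℂ)) u) ![a, b]
  let d : R ⊕ Fin 2 → ℂ := Sum.elim (fun r => (r : ℂ)) (fun _ => 0)
  have hv : ∀ i, T (v i) = d i • v i := by
    rintro (r | i)
    · have hdvd : (X - C (r : ℂ)) * Lagrange.basis R id (r : ℂ) =
          C (Lagrange.nodalWeight R id (r : ℂ)) * p := by
        rw [Lagrange.basis, ← hprod, ← Finset.mul_prod_erase _ _ r.2]
        simp only [Lagrange.basisDivisor, Lagrange.nodalWeight, Finset.prod_mul_distrib, map_prod,
          id]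
        ring
      have := congrArg (fun q => aeval T q u) hdvd
      simp only [map_mul, Module.End.mul_apply, hu, map_zero, map_sub, aeval_X, aeval_C,
        LinearMap.sub_apply, Module.algebraMap_end_apply] at this
      exact sub_eq_zero.mp this
    · fin_cases i
      · simpa [v, d] using ha
      · simpa [v, d] using hb
  have hspan : Submodule.span ℂ (Set.range v) = ⊤ := by
    apply hgen
    · intro w hw
      induction hw using Submodule.span_induction with
      | mem x hx =>
        obtain ⟨i, rfl⟩ := hx
        rw [hv]
        exact Submodule.smul_mem _ _ (Submodule.subset_span ⟨i, rfl⟩)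
      | zero => rw [map_zero]; exact Submodule.zero_mem _
      | add x y _ _ hx hy => rw [map_add]; exact Submodule.add_mem _ hx hy
      | smul c x _ hx => rw [map_smul]; exact Submodule.smul_mem _ _ hx
    · have h1 := Lagrange.sum_basis (s := R) (v := (id : ℂ → ℂ)) (Function.injective_id.injOn) hRne
      have h2 := congrArg (fun q => aeval T q u) h1
      simp only [map_sum, map_one, Module.End.one_apply, LinearMap.sum_apply] at h2
      rw [← h2]
      exact Submodule.sum_mem _ fun r hr => Submodule.subset_span ⟨Sum.inl ⟨r, hr⟩, rfl⟩
    · exact Submodule.subset_span ⟨Sum.inr 0, rfl⟩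
    · exact Submodule.subset_span ⟨Sum.inr 1, rfl⟩
  have hc : Fintype.card (R ⊕ Fin 2) = N := by
    rw [Fintype.card_sum, Fintype.card_coe, hcard, Fintype.card_fin, hdeg]
  have hli : LinearIndependent ℂ v :=
    linearIndependent_of_top_le_span_of_card_eq_finrank hspan.ge (by simp [hc])
  have hne : ∀ i, v i ≠ 0 := hli.ne_zero
  let e : Fin N ≃ R ⊕ Fin 2 := (Fintype.equivFinOfCardEq hc).symm
  let P : Matrix (Fin N) (Fin N) ℂ := Matrix.of fun i j => v (e j) i
  have hP : IsUnit P := by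
    rw [← Matrix.linearIndependent_cols_iff_isUnit]
    exact hli.comp e e.injective
  have hBP : B * P = P * Matrix.diagonal (d ∘ e) := by
    ext i j
    rw [Matrix.mul_diagonal]
    have := congrFun (hv (e j)) i
    rw [hT, Matrix.mulVecLin_apply] at this
    simp only [Pi.smul_apply, smul_eq_mul] at this
    rw [mul_comm (P i j)]
    exact this
  have hdet : IsUnit P.det := (Matrix.isUnit_iff_isUnit_det P).mp hP
  have hB : B = P * Matrix.diagonal (d ∘ e) * P⁻¹ := by
    rw [← hBP, Matrix.mul_assoc, Matrix.mul_nonsing_inv P hdet, Matrix.mul_one]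
  have haev : ∀ (q : ℂ[X]) i, aeval T q (v i) = q.eval (d i) • v i := fun q i =>
    Module.End.aeval_apply_of_mem_apply_eq_smul (hv i)
  have hmin : minpoly ℂ T = minpoly ℂ B := Matrix.minpoly_toLin' B
  refine ⟨?_, ?_, P, _, hP, Matrix.isDiag_diagonal _, hB⟩
  · rw [← hmin]
    have hint : IsIntegral ℂ T := Algebra.IsIntegral.isIntegral T
    have hroot : ∀ i, (minpoly ℂ T).eval (d i) = 0 := by
      intro i
      have := haev (minpoly ℂ T) i
      rw [minpoly.aeval, LinearMap.zero_apply] at this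
      exact (smul_eq_zero.mp this.symm).resolve_right (hne i)
    have hXp : (X * p).Monic := monic_X.mul hp
    refine eq_of_monic_of_associated (minpoly.monic hint) hXp
      (associated_of_dvd_dvd ?_ ?_)
    · apply minpoly.dvd
      have : ∀ x ∈ Submodule.span ℂ (Set.range v), aeval T (X * p) x = 0 := by
        intro x hx
        induction hx using Submodule.span_induction with
        | mem x hx =>
          obtain ⟨i, rfl⟩ := hx
          rw [haev]
          rcases i with r | i
          · have : p.eval (r : ℂ) = 0 := by
              exact (mem_roots hp.ne_zero).mp (Multiset.mem_toFinset.mp r.2)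
            simp [d, this]
          · simp [d]
        | zero => rw [map_zero]
        | add x y _ _ hx hy => rw [map_add, hx, hy, add_zero]
        | smul c x _ hx => rw [map_smul, hx, smul_zero]
      ext1 x
      ext j
      rw [LinearMap.comp_apply, this _ (by rw [hspan]; trivial)]
      simp
    · apply IsCoprime.mul_dvd
      · have : IsCoprime (X - C (0:ℂ)) p := by
          rw [(irreducible_X_sub_C (0:ℂ)).coprime_iff_not_dvd, dvd_iff_isRoot]
          exact hz
        simpa using this
      · have := dvd_iff_isRoot.mpr (hroot (Sum.inr 0))
        simpa [d] using this
      · rw [← hprod]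
        refine Finset.prod_dvd_of_coprime ?_ ?_
        · intro x _ y _ hxy
          exact pairwise_coprime_X_sub_C Function.injective_id hxy
        · intro r hr
          exact dvd_iff_isRoot.mpr (hroot (Sum.inl ⟨r, hr⟩))
  · obtain ⟨U, hU⟩ := hP
    have h1 : B = U.val * Matrix.diagonal (d ∘ e) * (U.val)⁻¹ := by
      rw [hU]; exact hB
    have : B.charpoly = ∏ i, (X - C ((d ∘ e) i)) := by
      rw [h1, Matrix.charpoly_units_conj, Matrix.charpoly_diagonal]
    rw [this]
    simp only [Function.comp]
    rw [Equiv.prod_comp e (fun i => (X - C (d i))), Fintype.prod_sum_type]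
    simp only [d, Sum.elim_inl, Sum.elim_inr, map_zero, sub_zero, Finset.prod_const,
      Finset.card_univ, Fintype.card_fin]
    rw [mul_comm, Finset.prod_coe_sort R (fun r => X - C r), hprod]

open Polynomial in
lemma poly_sep (n : ℕ) (hn : 2 ≤ n) : (X ^ (n+1) - C 2 * X ^ n - C 2 : ℂ[X]).Separable := by
  obtain ⟨m, rfl⟩ : ∃ m, n = m + 1 := ⟨n - 1, by omega⟩
  rw [Polynomial.separable_def]
  rw [Polynomial.isCoprime_iff_aeval_ne_zero_of_isAlgClosed ℂ ℂ]
  intro z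
  by_contra hc
  push Not at hc
  obtain ⟨h1, h2⟩ := hc
  simp at h1 h2
  have hz : z ≠ 0 := by
    rintro rfl
    simp at h1
  have h3 : z ^ m * (((m + 2 : ℕ) : ℂ) * z - 2 * ((m + 1 : ℕ) : ℂ)) = 0 := by
    rw [← h2]; push_cast; ring
  have h4 := (mul_eq_zero.mp h3).resolve_left (pow_ne_zero _ hz)
  have hm : ((m + 2 : ℕ) : ℂ) ≠ 0 := by exact_mod_cast (by omega : m + 2 ≠ 0)
  have h5 : z = ((2 * (m + 1) / (m + 2) : ℝ) : ℂ) := by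
    push_cast
    rw [eq_div_iff (by exact_mod_cast hm)]
    push_cast at h4
    linear_combination h4
  set x : ℝ := 2 * (m + 1) / (m + 2) with hx
  have hx0 : 0 < x := by positivity
  have hx2 : x < 2 := by
    rw [hx, div_lt_iff₀ (by positivity)]; linarith
  rw [h5] at h1
  have h6 : x ^ (m + 1 + 1) - 2 * x ^ (m + 1) - 2 = 0 := by exact_mod_cast h1
  have h7 : 0 < x ^ (m+1) := by positivity
  rw [pow_succ] at h6
  nlinarith
open Polynomial in
/-- For every `n ≥ 2` (with `κ_n` the unique `κ ∈ (0,1/2)` satisfying `(2+2κ)^n κ = 1`):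
the minimal polynomial of `B_n` is `X^{n+2} - 2X^{n+1} - 2X = X (X^{n+1} - 2X^n - 2)`,
its characteristic polynomial is `X^{n+3} - 2X^{n+2} - 2X² = X² (X^{n+1} - 2X^n - 2)`,
and `B_n` is diagonalizable over `ℂ`. -/
theorem Bmat_minpoly_charpoly_diagonalizable (n : ℕ) (hn : 2 ≤ n) (κ : ℝ)
    (hκ : κ ∈ Set.Ioo (0 : ℝ) (1/2)) (heq : (2 + 2*κ)^n * κ = 1) :
    minpoly ℂ (Bmat n κ) = X ^ (n + 2) - C 2 * X ^ (n + 1) - C 2 * X ∧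
    (Bmat n κ).charpoly = X ^ (n + 3) - C 2 * X ^ (n + 2) - C 2 * X ^ 2 ∧
    (∃ P D : Matrix (Fin (n + 3)) (Fin (n + 3)) ℂ,
      IsUnit P ∧ D.IsDiag ∧ Bmat n κ = P * D * P⁻¹) := by
  have h0 : 0 < κ := hκ.1
  set p : ℂ[X] := X ^ (n+1) - C 2 * X ^ n - C 2 with hpdef
  have hlow : (C 2 * X ^ n + C 2 : ℂ[X]).degree < ((n + 1 : ℕ) : WithBot ℕ) := by
    refine lt_of_le_of_lt (degree_le_of_natDegree_le (n := n) (by compute_degree)) ?_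
    exact_mod_cast Nat.lt_succ_self n
  have hp' : p = X ^ (n+1) - (C 2 * X ^ n + C 2) := by rw [hpdef]; ring
  have hmon : p.Monic := by rw [hp']; exact monic_X_pow_sub hlow
  have hdeg : p.natDegree = n + 1 := by
    rw [hp']
    apply natDegree_eq_of_degree_eq_some
    rw [degree_sub_eq_left_of_degree_lt (by rw [degree_X_pow]; exact hlow), degree_X_pow]
  have hz : p.eval 0 ≠ 0 := by
    simp [hpdef, show n ≠ 0 by omega]
  have hu : aeval (Bmat n κ).mulVecLin p (fvec n 1) = 0 := by
    simp only [hpdef, map_sub, map_mul, map_pow, aeval_X, aeval_C, LinearMap.sub_apply,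
      Module.End.mul_apply, Module.algebraMap_end_apply]
    rw [chain_n hn h0 heq, chain_succ hn h0 heq]
    module
  have key := diag_core (Bmat n κ) p hmon (poly_sep n hn) hz (by rw [hdeg]) (by omega)
    (fvec n 1) _ _ hu (kerA hn h0 heq) (kerB hn h0 heq) (gen_top hn h0 heq)
  refine ⟨?_, ?_, key.2.2⟩
  · rw [key.1, hpdef]; ring
  · rw [key.2.1, hpdef]; ring
end
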